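/- (Second ⁴φ³ identity of Andrews and Li–Chu) Let n be a nonnegative integer, let p be a nonzero complex number and set q = p², and let b, d be complex numbers with b ≠ 0 such that (q;q)_n ≠ 0, (dq;q)_n ≠ 0, (dp;q)_n ≠ 0, (b²q;q)_n ≠ 0, (−bp;p)_n ≠ 0, and (dp;p)_n ≠ 0. Then ∑_{j=0}^{n} ((q^{-n};q)_j (b;q)_j (bp;q)_j (d²q^{n+1};q)_j / ((q;q)_j (dq;q)_j (dp;q)_j (b²q;q)_j)) · q^j = b^n (−p;p)_n (dp/b;p)_n / ((−bp;p)_n (dp;p)_n). -/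

import Mathlib

/-- The $q$-shifted factorial $(a;q)_m = \prod_{k=0}^{m-1}(1 - a q^k)$. -/
noncomputable def qPoch (q a : ℂ) (m : ℕ) : ℂ := ∏ k ∈ Finset.range m, (1 - a * q ^ k)

open Polynomial in
/-- `f` is a polynomial function of degree at most `m`. -/
def IsPolyFun (m : ℕ) (f : ℂ → ℂ) : Prop :=
  ∃ P : ℂ[X], P.natDegree ≤ m ∧ ∀ x, P.eval x = f x

namespace IsPolyFun

lemma mono {m m' : ℕ} {f : ℂ → ℂ} (hf : IsPolyFun m f) (h : m ≤ m') : IsPolyFun m' f := by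
  obtain ⟨P, hP, hf⟩ := hf
  exact ⟨P, hP.trans h, hf⟩

lemma const (c : ℂ) : IsPolyFun 0 fun _ => c :=
  ⟨Polynomial.C c, by simp, by simp⟩

lemma mul {m m' : ℕ} {f g : ℂ → ℂ} (hf : IsPolyFun m f) (hg : IsPolyFun m' g) :
    IsPolyFun (m + m') fun x => f x * g x := by
  obtain ⟨P, hP, hf⟩ := hf
  obtain ⟨Q, hQ, hg⟩ := hg
  exact ⟨P * Q, Polynomial.natDegree_mul_le.trans (by omega), by simp [hf, hg]⟩

lemma const_mul {m : ℕ} {f : ℂ → ℂ} (c : ℂ) (hf : IsPolyFun m f) :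
    IsPolyFun m fun x => c * f x :=
  ((const c).mul hf).mono (by omega)

lemma sum {m : ℕ} {ι : Type*} (s : Finset ι) {f : ι → ℂ → ℂ}
    (hf : ∀ i ∈ s, IsPolyFun m (f i)) : IsPolyFun m fun x => ∑ i ∈ s, f i x := by
  classical
  induction s using Finset.induction_on with
  | empty => exact ((const 0).mono (Nat.zero_le m))
  | insert a s ha ih =>
    obtain ⟨P, hP, hf'⟩ := hf a (Finset.mem_insert_self a s)
    obtain ⟨Q, hQ, hg⟩ := ih fun i hi => hf i (Finset.mem_insert_of_mem hi)
    exact ⟨P + Q, Polynomial.natDegree_add_le_of_degree_le hP hQ, by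
      simp [hf', hg, Finset.sum_insert ha]⟩

lemma prod {m : ℕ} {f : ℕ → ℂ → ℂ} (k : ℕ) (hf : ∀ i, IsPolyFun m (f i)) :
    IsPolyFun (k * m) fun x => ∏ i ∈ Finset.range k, f i x := by
  induction k with
  | zero => simpa using const 1
  | succ k ih =>
    simp only [Finset.prod_range_succ]
    exact (ih.mul (hf k)).mono (by rw [Nat.succ_mul])

lemma linear (a c : ℂ) : IsPolyFun 1 fun x => a * x + c :=
  ⟨_, Polynomial.natDegree_linear_le (a := a) (b := c), by simp⟩

lemma qPoch_linear (q a : ℂ) (k : ℕ) : IsPolyFun k fun x => qPoch q (a * x) k := by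
  have h := prod (f := fun i x => 1 - a * x * q ^ i) (m := 1) k fun i => by
    convert linear (-(a * q ^ i)) 1 using 2
    ring
  simpa [qPoch] using h

lemma qPoch_quadratic (q a : ℂ) (k : ℕ) : IsPolyFun (2 * k) fun x => qPoch q (x ^ 2 * a) k := by
  have h := prod (f := fun i x => 1 - x ^ 2 * a * q ^ i) (m := 2) k fun i =>
    ⟨Polynomial.C (-(a * q ^ i)) * Polynomial.X ^ 2 + Polynomial.C 1,
      by compute_degree, fun x => by simp; ring⟩
  rw [mul_comm]
  simpa [qPoch] using h

lemma eq_of_eval_eq {m : ℕ} {f g : ℂ → ℂ} (hf : IsPolyFun m f) (hg : IsPolyFun m g)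
    {ι : Type*} [Fintype ι] {v : ι → ℂ} (hv : Function.Injective v)
    (hcard : m < Fintype.card ι) (h : ∀ i, f (v i) = g (v i)) (x : ℂ) : f x = g x := by
  obtain ⟨P, hP, hf⟩ := hf
  obtain ⟨Q, hQ, hg⟩ := hg
  have hPQ : P = Q := Polynomial.eq_of_natDegree_lt_card_of_eval_eq P Q hv
    (fun i => by rw [hf, hg, h]) (by omega)
  rw [← hf, ← hg, hPQ]

end IsPolyFun

lemma qPoch_add (q a : ℂ) (m k : ℕ) :
    qPoch q a (m + k) = qPoch q a m * qPoch q (a * q ^ m) k := by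
  simp [qPoch, Finset.prod_range_add, pow_add, mul_assoc]

lemma qPoch_ne_zero_iff {q a : ℂ} {n : ℕ} :
    qPoch q a n ≠ 0 ↔ ∀ k < n, a * q ^ k ≠ 1 := by
  simp only [qPoch, Finset.prod_ne_zero_iff, Finset.mem_range, sub_ne_zero]
  exact forall₂_congr fun _ _ => ne_comm

lemma qPoch_eq_zero {q a : ℂ} {n k : ℕ} (hk : k < n) (h : a * q ^ k = 1) :
    qPoch q a n = 0 := by
  by_contra h'
  exact qPoch_ne_zero_iff.1 h' k hk h

lemma qPoch_ne_zero_of_le {q a : ℂ} {n k : ℕ} (h : qPoch q a n ≠ 0) (hk : k ≤ n) :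
    qPoch q a k ≠ 0 :=
  qPoch_ne_zero_iff.2 fun i hi => qPoch_ne_zero_iff.1 h i (hi.trans_le hk)

lemma qPoch_succ (q a : ℂ) (n : ℕ) : qPoch q a (n + 1) = qPoch q a n * (1 - a * q ^ n) :=
  Finset.prod_range_succ _ _

lemma qPoch_two_mul (p a : ℂ) (j : ℕ) :
    qPoch p a (2 * j) = qPoch (p ^ 2) a j * qPoch (p ^ 2) (a * p) j := by
  induction j with
  | zero => simp [qPoch]
  | succ j ih =>
    rw [show 2 * (j + 1) = 2 * j + 1 + 1 by ring, qPoch_succ, qPoch_succ, ih, qPoch_succ,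
      qPoch_succ]
    ring

lemma qPoch_sq (p a : ℂ) (n : ℕ) :
    qPoch (p ^ 2) (a ^ 2) n = qPoch p a n * qPoch p (-a) n := by
  simp only [qPoch, ← Finset.prod_mul_distrib]
  exact Finset.prod_congr rfl fun k _ => by ring

lemma qPoch_exchange (q a : ℂ) {n j k : ℕ} (hj : j ≤ n) (hk : k ≤ n) :
    qPoch q (a * q ^ n) j * qPoch q (a * q ^ (k + j)) (n - j) =
      qPoch q (a * q ^ n) k * qPoch q (a * q ^ (k + j)) (n - k) := by
  rcases le_total j k with h | h
  · obtain ⟨r, rfl⟩ := Nat.exists_eq_add_of_le h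
    obtain ⟨s, rfl⟩ := Nat.exists_eq_add_of_le hk
    rw [show j + r + s - j = s + r by omega, show j + r + s - (j + r) = s by omega,
      qPoch_add q _ j r, qPoch_add q _ s r]
    ring_nf
  · obtain ⟨r, rfl⟩ := Nat.exists_eq_add_of_le h
    obtain ⟨s, rfl⟩ := Nat.exists_eq_add_of_le hj
    rw [show k + r + s - k = s + r by omega, show k + r + s - (k + r) = s by omega,
      qPoch_add q _ k r, qPoch_add q _ s r]
    ring_nf

lemma sum_qPoch_mul_pow_eq_zero {q : ℂ} (hq : q ≠ 0) {n : ℕ} (h : qPoch q q n ≠ 0) (i : ℕ)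
    (hi : i < n) :
    ∑ j ∈ Finset.range (n + 1),
      qPoch q (q ^ (-(n : ℤ))) j / qPoch q q j * (q ^ (i + 1)) ^ j = 0 := by
  set w : ℕ → ℂ := fun j => qPoch q (q ^ (-(n : ℤ))) j / qPoch q q j with hw
  have hne : ∀ k, 1 ≤ k → k ≤ n → 1 - q ^ k ≠ 0 := fun k hk hkn => by
    have := qPoch_ne_zero_iff.1 h (k - 1) (by omega)
    rw [← pow_succ', Nat.sub_add_cancel hk] at this
    exact sub_ne_zero.2 this.symm
  have hqn : q ^ (-(n : ℤ)) * q ^ n = 1 := by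
    rw [zpow_neg, zpow_natCast, inv_mul_cancel₀ (pow_ne_zero _ hq)]
  have hstep : ∀ j < n, w (j + 1) * (1 - q ^ (j + 1)) = w j * (1 - q ^ (-(n : ℤ)) * q ^ j) := by
    intro j hj
    have h1 := qPoch_ne_zero_of_le h hj.le
    have h2 := hne (j + 1) (by omega) (by omega)
    simp only [hw, qPoch_succ, ← pow_succ']
    field_simp
  have hfun : ∀ z : ℂ, (1 - z) * ∑ j ∈ Finset.range (n + 1), w j * z ^ j =
      (1 - z * q ^ (-(n : ℤ))) * ∑ j ∈ Finset.range (n + 1), w j * (q * z) ^ j := by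
    intro z
    have hl : ∑ j ∈ Finset.range (n + 1), w j * (1 - q ^ j) * z ^ j =
        z * ∑ j ∈ Finset.range (n + 1), w j * (1 - q ^ (-(n : ℤ)) * q ^ j) * z ^ j := by
      rw [Finset.sum_range_succ', Finset.sum_range_succ, hqn]
      simp only [pow_zero, sub_self, mul_zero, zero_mul, add_zero, Finset.mul_sum]
      refine Finset.sum_congr rfl fun j hj => ?_
      rw [hstep j (Finset.mem_range.1 hj)]
      ring
    have e1 : ∑ j ∈ Finset.range (n + 1), w j * (1 - q ^ j) * z ^ j =
        ∑ j ∈ Finset.range (n + 1), w j * z ^ j -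
          ∑ j ∈ Finset.range (n + 1), w j * (q * z) ^ j := by
      rw [← Finset.sum_sub_distrib]
      exact Finset.sum_congr rfl fun j _ => by ring
    have e2 : ∑ j ∈ Finset.range (n + 1), w j * (1 - q ^ (-(n : ℤ)) * q ^ j) * z ^ j =
        ∑ j ∈ Finset.range (n + 1), w j * z ^ j -
          q ^ (-(n : ℤ)) * ∑ j ∈ Finset.range (n + 1), w j * (q * z) ^ j := by
      rw [Finset.mul_sum, ← Finset.sum_sub_distrib]
      exact Finset.sum_congr rfl fun j _ => by ring
    rw [e1, e2] at hl
    linear_combination hl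
  have hcoef : ∀ i < n, 1 - q ^ i * q ^ (-(n : ℤ)) ≠ 0 := by
    intro i hi h0
    apply hne (n - i) (by omega) (by omega)
    have : q ^ n = q ^ i * q ^ (n - i) := by rw [← pow_add]; congr 1; omega
    rw [this] at hqn
    linear_combination -hqn - q ^ (n - i) * h0
  change ∑ j ∈ Finset.range (n + 1), w j * (q ^ (i + 1)) ^ j = 0
  induction i with
  | zero =>
    have := hfun 1
    rw [sub_self, zero_mul, eq_comm, mul_eq_zero] at this
    simpa using this.resolve_left (by simpa using hcoef 0 hi)
  | succ i ih =>
    have := hfun (q ^ (i + 1))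
    rw [ih (by omega), mul_zero, eq_comm, mul_eq_zero] at this
    simpa [pow_succ' q (i + 1)] using this.resolve_left (hcoef (i + 1) hi)

lemma sum_qPoch_mul_isPolyFun_eq_zero {q : ℂ} (hq : q ≠ 0) {n m : ℕ} (h : qPoch q q n ≠ 0)
    {f : ℂ → ℂ} (hf : IsPolyFun m f) (hm : m < n) :
    ∑ j ∈ Finset.range (n + 1),
      qPoch q (q ^ (-(n : ℤ))) j / qPoch q q j * q ^ j * f (q ^ j) = 0 := by
  obtain ⟨P, hP, hf⟩ := hf
  simp only [← hf, P.eval_eq_sum_range' (hP.trans_lt hm), Finset.mul_sum]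
  rw [Finset.sum_comm]
  refine Finset.sum_eq_zero fun i hi => ?_
  have := sum_qPoch_mul_pow_eq_zero hq h i (Finset.mem_range.1 hi)
  rw [← mul_zero (P.coeff i), ← this, Finset.mul_sum]
  exact Finset.sum_congr rfl fun j _ => by ring

/-- The coefficients of the terminating series that do not involve `b`. -/
noncomputable def andrewsCoeff (p d : ℂ) (n j : ℕ) : ℂ :=
  qPoch (p ^ 2) ((p ^ 2) ^ (-(n : ℤ))) j * qPoch (p ^ 2) (d ^ 2 * (p ^ 2) ^ (n + 1)) j /
    (qPoch (p ^ 2) (p ^ 2) j * qPoch p (d * p) (2 * j)) * (p ^ 2) ^ j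

/-- The series multiplied by `(b²q;q)_n`, a polynomial in `b`. -/
noncomputable def andrewsPoly (p d : ℂ) (n : ℕ) (b : ℂ) : ℂ :=
  ∑ j ∈ Finset.range (n + 1), andrewsCoeff p d n j * qPoch p b (2 * j) *
    qPoch (p ^ 2) (b ^ 2 * (p ^ 2) ^ (j + 1)) (n - j)

lemma isPolyFun_andrewsPoly (p d : ℂ) (n : ℕ) : IsPolyFun (2 * n) (andrewsPoly p d n) := by
  refine IsPolyFun.sum _ fun j hj => ?_
  have hj := Finset.mem_range.1 hj
  have h := ((IsPolyFun.qPoch_linear p 1 (2 * j)).const_mul (andrewsCoeff p d n j)).mul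
    (IsPolyFun.qPoch_quadratic (p ^ 2) ((p ^ 2) ^ (j + 1)) (n - j))
  simp only [one_mul] at h
  exact h.mono (by omega)

lemma andrewsPoly_one (p d : ℂ) (n : ℕ) : andrewsPoly p d n 1 = qPoch (p ^ 2) (p ^ 2) n := by
  rw [andrewsPoly, Finset.sum_eq_single 0]
  · simp [andrewsCoeff, qPoch]
  · intro j _ hj
    rw [qPoch_eq_zero (q := p) (a := 1) (k := 0) (by omega) (by simp)]
    simp
  · simp

lemma andrewsPoly_inv_pow {p : ℂ} (hp : p ≠ 0) (d : ℂ) {n m : ℕ} (hm : 1 ≤ m) (hmn : m ≤ n) :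
    andrewsPoly p d n (p ^ m)⁻¹ = 0 := by
  refine Finset.sum_eq_zero fun j hj => ?_
  have hpm := pow_ne_zero m hp
  rcases lt_or_ge j m with h | h
  · rw [qPoch_eq_zero (q := p ^ 2) (k := m - (j + 1)) (by omega), mul_zero]
    rw [mul_assoc, ← pow_add, show j + 1 + (m - (j + 1)) = m by omega, ← pow_mul, mul_comm 2 m, pow_mul]
    field_simp
  · rw [qPoch_eq_zero (q := p) (a := (p ^ m)⁻¹) (k := m) (by omega) (inv_mul_cancel₀ hpm)]
    simp

lemma andrewsPoly_mul_pow {p d : ℂ} {n k : ℕ} (hp : p ≠ 0) (hq : qPoch (p ^ 2) (p ^ 2) n ≠ 0)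
    (hd : qPoch p (d * p) (2 * n) ≠ 0) (hk : k < n) :
    andrewsPoly p d n (d * p ^ (k + 1)) = 0 := by
  have hf := ((IsPolyFun.qPoch_linear p (d * p) k).mul
    (IsPolyFun.qPoch_linear (p ^ 2) (d ^ 2 * p ^ 2 * (p ^ 2) ^ (k + 1)) (n - (k + 1)))).const_mul
    (qPoch (p ^ 2) (d ^ 2 * p ^ 2 * (p ^ 2) ^ n) (k + 1) / qPoch p (d * p) k)
  have h0 := sum_qPoch_mul_isPolyFun_eq_zero (pow_ne_zero 2 hp) hq hf (by omega)
  rw [← h0]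
  refine Finset.sum_congr rfl fun j hj => ?_
  have hj : j ≤ n := Nat.lt_succ_iff.1 (Finset.mem_range.1 hj)
  have hex := qPoch_exchange (p ^ 2) (d ^ 2 * p ^ 2) hj (Nat.succ_le_of_lt hk)
  have hswap : qPoch p (d * p) k * qPoch p (d * p ^ (k + 1)) (2 * j) =
      qPoch p (d * p) (2 * j) * qPoch p (d * p * (p ^ 2) ^ j) k := by
    have h1 := qPoch_add p (d * p) k (2 * j)
    rw [add_comm, qPoch_add] at h1
    rw [← pow_mul, h1, pow_succ']
    ring_nf
  have hne1 := qPoch_ne_zero_of_le hq hj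
  have hne2 := qPoch_ne_zero_of_le hd (show 2 * j ≤ 2 * n by omega)
  have hne3 := qPoch_ne_zero_of_le hd (show k ≤ 2 * n by omega)
  have e1 : d ^ 2 * (p ^ 2) ^ (n + 1) = d ^ 2 * p ^ 2 * (p ^ 2) ^ n := by ring
  have e2 : (d * p ^ (k + 1)) ^ 2 * (p ^ 2) ^ (j + 1) =
      d ^ 2 * p ^ 2 * (p ^ 2) ^ (k + 1 + j) := by ring
  have e3 : d ^ 2 * p ^ 2 * (p ^ 2) ^ (k + 1) * (p ^ 2) ^ j =
      d ^ 2 * p ^ 2 * (p ^ 2) ^ (k + 1 + j) := by ring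
  rw [Nat.succ_eq_add_one] at hex
  rw [andrewsCoeff, e1, e2, e3]
  generalize qPoch (p ^ 2) (d ^ 2 * p ^ 2 * (p ^ 2) ^ n) j = A at *
  generalize qPoch (p ^ 2) (d ^ 2 * p ^ 2 * (p ^ 2) ^ (k + 1 + j)) (n - j) = B at *
  generalize qPoch (p ^ 2) (d ^ 2 * p ^ 2 * (p ^ 2) ^ n) (k + 1) = C at *
  generalize qPoch (p ^ 2) (d ^ 2 * p ^ 2 * (p ^ 2) ^ (k + 1 + j)) (n - (k + 1)) = D at *
  generalize qPoch p (d * p ^ (k + 1)) (2 * j) = E at *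
  generalize qPoch p (d * p * (p ^ 2) ^ j) k = F at *
  generalize qPoch p (d * p) k = G at *
  generalize qPoch p (d * p) (2 * j) = H at *
  generalize qPoch (p ^ 2) ((p ^ 2) ^ (-(n : ℤ))) j = I at *
  generalize qPoch (p ^ 2) (p ^ 2) j = J at *
  generalize (p ^ 2) ^ j = K at *
  simp only [div_mul_eq_mul_div]
  rw [← mul_div_assoc, div_div, div_eq_div_iff (mul_ne_zero hne1 hne2) (mul_ne_zero hne3 hne1)]
  linear_combination (I * K * J * E * G) * hex + (I * K * J * C * D) * hswap

/-- The closed form multiplied by `(b²q;q)_n`, a polynomial in `b`. -/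
noncomputable def andrewsClosedForm (p d : ℂ) (n : ℕ) (b : ℂ) : ℂ :=
  qPoch p (-p) n / qPoch p (d * p) n *
    ((∏ k ∈ Finset.range n, (b - d * p ^ (k + 1))) * qPoch p (p * b) n)

lemma isPolyFun_andrewsClosedForm (p d : ℂ) (n : ℕ) :
    IsPolyFun (2 * n) (andrewsClosedForm p d n) := by
  have h := IsPolyFun.prod (f := fun k x => x - d * p ^ (k + 1)) (m := 1) n fun k => by
    convert IsPolyFun.linear 1 (-(d * p ^ (k + 1))) using 2
    ring
  exact ((h.mul (IsPolyFun.qPoch_linear p p n)).const_mul _).mono (by omega)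

lemma andrewsPoly_eq_of_ne_zero {p d : ℂ} {n : ℕ} (hp : p ≠ 0) (hd0 : d ≠ 0)
    (hq : qPoch (p ^ 2) (p ^ 2) n ≠ 0) (hd : qPoch p (d * p) (2 * n) ≠ 0) (b : ℂ) :
    andrewsPoly p d n b = andrewsClosedForm p d n b := by
  have hpow : ∀ i j : ℕ, i ≤ n → j ≤ n → p ^ i = p ^ j → i = j := by
    have key : ∀ i r : ℕ, i + r ≤ n → p ^ i = p ^ (i + r) → r = 0 := by
      intro i r hr h
      by_contra h0
      rw [pow_add, eq_comm, mul_eq_left₀ (pow_ne_zero i hp)] at h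
      apply qPoch_ne_zero_iff.1 hq (r - 1) (by omega)
      rw [← pow_succ', Nat.sub_add_cancel (by omega), ← pow_mul, mul_comm, pow_mul, h, one_pow]
    intro i j hi hj h
    rcases le_total i j with hij | hij <;> obtain ⟨r, rfl⟩ := Nat.exists_eq_add_of_le hij
    · simp [key i r hj h]
    · simp [key j r hi h.symm]
  have hmix : ∀ i k : ℕ, i ≤ n → k < n → (p ^ i)⁻¹ ≠ d * p ^ (k + 1) := by
    intro i k hi hk h
    apply qPoch_ne_zero_iff.1 hd (i + k) (by omega)
    rw [← inv_mul_cancel₀ (pow_ne_zero i hp), h]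
    ring
  refine (isPolyFun_andrewsPoly p d n).eq_of_eval_eq (isPolyFun_andrewsClosedForm p d n)
    (v := Sum.elim (fun i : Fin (n + 1) => (p ^ (i : ℕ))⁻¹)
      (fun k : Fin n => d * p ^ ((k : ℕ) + 1))) ?_ (by simp; omega) ?_ b
  · refine Function.Injective.sumElim ?_ ?_ ?_
    · intro i j h
      exact Fin.ext (hpow i j (by omega) (by omega) (inv_injective h))
    · intro i j h
      have := hpow _ _ (by omega) (by omega) (mul_left_cancel₀ hd0 h)
      exact Fin.ext (by omega)
    · intro i k
      exact hmix i k (by omega) k.2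
  · rintro (⟨i, hi⟩ | ⟨k, hk⟩)
    · rcases Nat.eq_zero_or_pos i with rfl | hi0
      · have hdn := qPoch_ne_zero_of_le hd (show n ≤ 2 * n by omega)
        have e : ∏ k ∈ Finset.range n, (1 - d * p ^ (k + 1)) = qPoch p (d * p) n :=
          Finset.prod_congr rfl fun k _ => by ring
        simp only [Sum.elim_inl, pow_zero, inv_one, andrewsPoly_one, andrewsClosedForm, e,
          mul_one, qPoch_sq p p n]
        rw [div_mul_eq_mul_div, eq_div_iff hdn]
        ring
      · simp only [Sum.elim_inl]
        rw [andrewsPoly_inv_pow hp d hi0 (by omega), andrewsClosedForm,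
          qPoch_eq_zero (q := p) (a := p * (p ^ i)⁻¹) (k := i - 1) (by omega)]
        · simp
        · rw [mul_right_comm, ← pow_succ', Nat.sub_add_cancel hi0,
            mul_inv_cancel₀ (pow_ne_zero i hp)]
    · simp only [Sum.elim_inr]
      rw [andrewsPoly_mul_pow hp hq hd hk, andrewsClosedForm,
        Finset.prod_eq_zero (Finset.mem_range.2 hk) (sub_self _)]
      simp

lemma continuous_qPoch {q : ℂ} {f : ℂ → ℂ} (hf : Continuous f) (n : ℕ) :
    Continuous fun x => qPoch q (f x) n := by
  unfold qPoch
  fun_prop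

open Filter Topology in
lemma andrewsPoly_eq {p d : ℂ} {n : ℕ} (hp : p ≠ 0)
    (hq : qPoch (p ^ 2) (p ^ 2) n ≠ 0) (hd : qPoch p (d * p) (2 * n) ≠ 0) (b : ℂ) :
    andrewsPoly p d n b = andrewsClosedForm p d n b := by
  rcases eq_or_ne d 0 with rfl | hd0
  swap
  · exact andrewsPoly_eq_of_ne_zero hp hd0 hq hd b
  have hc : ∀ m, Continuous fun x : ℂ => qPoch p (x * p) m := fun m =>
    continuous_qPoch (by fun_prop) m
  have hl : ContinuousAt (fun x => andrewsPoly p x n b) 0 := by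
    unfold andrewsPoly andrewsCoeff
    refine tendsto_finsetSum _ fun j hj => ?_
    have hj := Finset.mem_range.1 hj
    refine ContinuousAt.mul (ContinuousAt.mul (ContinuousAt.mul (ContinuousAt.div ?_ ?_ ?_) ?_)
      ?_) ?_
    · exact (continuous_const.mul (continuous_qPoch (by fun_prop) j)).continuousAt
    · exact (continuous_const.mul (hc _)).continuousAt
    · exact mul_ne_zero (qPoch_ne_zero_of_le hq (by omega)) (qPoch_ne_zero_of_le hd (by omega))
    all_goals exact continuousAt_const
  have hr : ContinuousAt (fun x => andrewsClosedForm p x n b) 0 := by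
    unfold andrewsClosedForm
    refine ContinuousAt.mul (ContinuousAt.div continuousAt_const (hc n).continuousAt
      (qPoch_ne_zero_of_le hd (by omega))) ?_
    exact Continuous.continuousAt (by fun_prop)
  have hev : ∀ᶠ x in 𝓝[≠] (0 : ℂ), andrewsPoly p x n b = andrewsClosedForm p x n b := by
    filter_upwards [self_mem_nhdsWithin,
      nhdsWithin_le_nhds ((hc (2 * n)).continuousAt.eventually_ne hd)] with x hx hxd
    exact andrewsPoly_eq_of_ne_zero hp hx hq hxd b
  exact tendsto_nhds_unique ((hl.tendsto.mono_left nhdsWithin_le_nhds).congr' hev)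
    (hr.tendsto.mono_left nhdsWithin_le_nhds)

/-- Second ${}_4\phi_3$ identity of Andrews and Li–Chu, with $q = p^2$. -/
theorem andrews_li_chu_second (n : ℕ) (p b d : ℂ) (hp : p ≠ 0) (hb : b ≠ 0)
    (h1 : qPoch (p ^ 2) (p ^ 2) n ≠ 0) (h2 : qPoch (p ^ 2) (d * p ^ 2) n ≠ 0)
    (h3 : qPoch (p ^ 2) (d * p) n ≠ 0) (h4 : qPoch (p ^ 2) (b ^ 2 * p ^ 2) n ≠ 0)
    (h5 : qPoch p (-(b * p)) n ≠ 0) (h6 : qPoch p (d * p) n ≠ 0) :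
    ∑ j ∈ Finset.range (n + 1),
      qPoch (p ^ 2) ((p ^ 2) ^ (-(n : ℤ))) j * qPoch (p ^ 2) b j * qPoch (p ^ 2) (b * p) j *
        qPoch (p ^ 2) (d ^ 2 * (p ^ 2) ^ (n + 1)) j /
        (qPoch (p ^ 2) (p ^ 2) j * qPoch (p ^ 2) (d * p ^ 2) j * qPoch (p ^ 2) (d * p) j *
          qPoch (p ^ 2) (b ^ 2 * p ^ 2) j) * (p ^ 2) ^ j
    = b ^ n * qPoch p (-p) n * qPoch p (d * p / b) n /
        (qPoch p (-(b * p)) n * qPoch p (d * p) n) := by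
  have hd : qPoch p (d * p) (2 * n) ≠ 0 := by
    rw [qPoch_two_mul, mul_assoc, ← pow_two]
    exact mul_ne_zero h3 h2
  have hsq := qPoch_sq p (b * p) n
  rw [mul_pow] at hsq
  have h7 : qPoch p (b * p) n ≠ 0 := fun h => h4 (by rw [hsq, h, zero_mul])
  have hpoly := andrewsPoly_eq hp h1 hd b
  have hsum : (∑ j ∈ Finset.range (n + 1),
      qPoch (p ^ 2) ((p ^ 2) ^ (-(n : ℤ))) j * qPoch (p ^ 2) b j * qPoch (p ^ 2) (b * p) j *
        qPoch (p ^ 2) (d ^ 2 * (p ^ 2) ^ (n + 1)) j /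
        (qPoch (p ^ 2) (p ^ 2) j * qPoch (p ^ 2) (d * p ^ 2) j * qPoch (p ^ 2) (d * p) j *
          qPoch (p ^ 2) (b ^ 2 * p ^ 2) j) * (p ^ 2) ^ j) * qPoch (p ^ 2) (b ^ 2 * p ^ 2) n =
      andrewsPoly p d n b := by
    rw [andrewsPoly, Finset.sum_mul]
    refine Finset.sum_congr rfl fun j hj => ?_
    have hj : j ≤ n := Nat.lt_succ_iff.1 (Finset.mem_range.1 hj)
    have hadd := qPoch_add (p ^ 2) (b ^ 2 * p ^ 2) j (n - j)
    rw [Nat.add_sub_cancel' hj, mul_assoc (b ^ 2), ← pow_succ' (p ^ 2)] at hadd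
    have hne := qPoch_ne_zero_of_le h4 hj
    rw [hadd, andrewsCoeff, qPoch_two_mul, qPoch_two_mul, mul_assoc d p p, ← pow_two]
    have hne1 := qPoch_ne_zero_of_le h1 hj
    have hne2 := qPoch_ne_zero_of_le h2 hj
    have hne3 := qPoch_ne_zero_of_le h3 hj
    generalize qPoch (p ^ 2) (b ^ 2 * p ^ 2) j = A at *
    generalize qPoch (p ^ 2) (d * p ^ 2) j = B at *
    generalize qPoch (p ^ 2) (d * p) j = C at *
    field_simp
  have hprod : ∏ k ∈ Finset.range n, (b - d * p ^ (k + 1)) = b ^ n * qPoch p (d * p / b) n := by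
    conv_rhs => rw [← Finset.card_range n, ← Finset.prod_const, Finset.card_range, qPoch,
      ← Finset.prod_mul_distrib]
    refine Finset.prod_congr rfl fun k _ => ?_
    field_simp
    ring
  rw [hpoly, andrewsClosedForm, hprod, hsq, mul_comm p b] at hsum
  refine mul_right_cancel₀ (mul_ne_zero h7 h5) (hsum.trans ?_)
  generalize qPoch p (-(b * p)) n = A at *
  generalize qPoch p (d * p) n = B at *
  field_simp
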